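/- arXiv:2501.12668 — 3 statements merged into one kernel-verified Lean document; each statement's English description precedes it below -/
import Mathlib

section
/- Let S be a finite nonempty state space, O a finite nonempty set of options, and γ ∈ [0,1) a discount factor. Suppose each option o ∈ O is given by a one-step transition kernel P_o : S → PMF(S), a one-step expected reward r_o : S → ℝ, and a termination probability β_o : S → [0,1], and let μ : S → PMF(O) be a meta-control policy. Let (Q, V) be a solution of the coupled Bellman equations Q(s,o) = r_o(s) + γ·Σ_{s'} P_o(s'|s)·[(1 − β_o(s'))·Q(s',o) + β_o(s')·V(s')] and V(s) = Σ_o μ(o|s)·Q(s,o). Define the interrupted termination probabilities β'_o(s) = 1 if V(s) > Q(s,o) and β'_o(s) = β_o(s) otherwise, and let (Q', V') be a solution of the same coupled Bellman equations with β replaced by β' (same P_o, r_o, μ). Then V'(s) ≥ V(s) for every state s ∈ S. -/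
/-- The expectation of a function bounded above by `M` under a finitely supported probability mass
function is at most `M`. -/
theorem PMF.sum_toReal_mul_le {α : Type*} [Fintype α] (p : PMF α) {f : α → ℝ} {M : ℝ}
    (hf : ∀ a, f a ≤ M) : ∑ a, (p a).toReal * f a ≤ M := by
  have hsum : ∑ a, (p a).toReal = 1 := by
    rw [← ENNReal.toReal_sum fun a _ => p.apply_ne_top a, ← tsum_fintype (L := .unconditional α),
      p.tsum_coe, ENNReal.toReal_one]
  calc ∑ a, (p a).toReal * f a ≤ ∑ a, (p a).toReal * M :=
        Finset.sum_le_sum fun a _ => mul_le_mul_of_nonneg_left (hf a) ENNReal.toReal_nonneg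
    _ = M := by rw [← Finset.sum_mul, hsum, one_mul]

/-- **Termination Improvement (Theorem 1, after Sutton, Precup and Singh).**
Given a finite nonempty state space `S`, a finite nonempty set of options `O`,
a discount factor `γ ∈ [0,1)`, options with kernels `P`, rewards `r`, termination
probabilities `β`, and a meta-control policy `μ`, let `(Q, V)` solve the coupled
Bellman equations.  Interrupting each option additionally whenever `V s > Q s o`
(i.e. replacing `β` by `β'`) yields a solution `(Q', V')` with `V' s ≥ V s` for all `s`. -/
theorem termination_improvement_state_value
    {S O : Type} [Fintype S] [Nonempty S] [Fintype O] [Nonempty O]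
    (γ : ℝ) (hγ0 : 0 ≤ γ) (hγ1 : γ < 1)
    (P : O → S → PMF S) (r : O → S → ℝ) (β : O → S → ℝ)
    (hβ0 : ∀ o s, 0 ≤ β o s) (hβ1 : ∀ o s, β o s ≤ 1)
    (μ : S → PMF O)
    (Q : S → O → ℝ) (V : S → ℝ)
    (hQ : ∀ s o, Q s o =
      r o s + γ * ∑ s' : S, (P o s s').toReal *
        ((1 - β o s') * Q s' o + β o s' * V s'))
    (hV : ∀ s, V s = ∑ o : O, (μ s o).toReal * Q s o)
    (β' : O → S → ℝ)
    (hβ' : ∀ o s, β' o s = if V s > Q s o then 1 else β o s)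
    (Q' : S → O → ℝ) (V' : S → ℝ)
    (hQ' : ∀ s o, Q' s o =
      r o s + γ * ∑ s' : S, (P o s s').toReal *
        ((1 - β' o s') * Q' s' o + β' o s' * V' s'))
    (hV' : ∀ s, V' s = ∑ o : O, (μ s o).toReal * Q' s o) :
    ∀ s : S, V' s ≥ V s := by
  obtain ⟨⟨s₀, o₀⟩, hmax⟩ := Finite.exists_max fun x : S × O => Q x.1 x.2 - Q' x.1 x.2
  set M := Q s₀ o₀ - Q' s₀ o₀ with hM
  have hQM : ∀ s o, Q s o - Q' s o ≤ M := fun s o => hmax (s, o)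
  have hVM : ∀ s, V s - V' s ≤ M := by
    intro s
    rw [hV s, hV' s, ← Finset.sum_sub_distrib]
    simp only [← mul_sub]
    exact (μ s).sum_toReal_mul_le (hQM s)
  have hstep : ∀ s, ((1 - β o₀ s) * Q s o₀ + β o₀ s * V s) -
      ((1 - β' o₀ s) * Q' s o₀ + β' o₀ s * V' s) ≤ M := by
    intro s
    have h0 := hβ0 o₀ s
    have h1 := hβ1 o₀ s
    rw [hβ' o₀ s]
    split_ifs with h
    · nlinarith [hVM s, mul_nonneg (sub_nonneg.2 h1) (sub_nonneg.2 h.le)]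
    · nlinarith [mul_le_mul_of_nonneg_left (hQM s o₀) (sub_nonneg.2 h1),
        mul_le_mul_of_nonneg_left (hVM s) h0]
  have hcontr : M ≤ γ * M := by
    calc M = γ * ∑ s, (P o₀ s₀ s).toReal * (((1 - β o₀ s) * Q s o₀ + β o₀ s * V s) -
          ((1 - β' o₀ s) * Q' s o₀ + β' o₀ s * V' s)) := by
          simp only [mul_sub (ENNReal.toReal _), Finset.sum_sub_distrib]
          rw [hM, hQ s₀ o₀, hQ' s₀ o₀]
          ring
      _ ≤ γ * M := mul_le_mul_of_nonneg_left ((P o₀ s₀).sum_toReal_mul_le hstep) hγ0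
  intro s
  have hM0 : M ≤ 0 := by nlinarith
  linarith [hVM s]
end

section
/- Let S be a finite nonempty state space, O a finite nonempty set of options, γ ∈ [0,1), options given by kernels P_o : S → PMF(S), rewards r_o : S → ℝ, and termination probabilities β_o : S → [0,1], and μ : S → PMF(O) a meta-control policy. Let (Q, V) solve the coupled Bellman equations Q(s,o) = r_o(s) + γ·Σ_{s'} P_o(s'|s)·[(1 − β_o(s'))·Q(s',o) + β_o(s')·V(s')] and V(s) = Σ_o μ(o|s)·Q(s,o). Define β'_o(s) = 1 if V(s) > Q(s,o) and β'_o(s) = β_o(s) otherwise, and let (Q', V') solve the same coupled Bellman equations with β replaced by β'. Then Q'(s,o) ≥ Q(s,o) for every state s ∈ S and every option o ∈ O. -/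
theorem PMF.sum_toReal_eq_one {α : Type*} [Fintype α] (p : PMF α) :
    ∑ a, (p a).toReal = 1 := by
  rw [← ENNReal.toReal_sum fun a _ => p.apply_ne_top a, ← tsum_fintype (L := .unconditional α), p.tsum_coe,
    ENNReal.toReal_one]

theorem PMF.sum_toReal_mul_add_const_le {α : Type*} [Fintype α] (p : PMF α) {f g : α → ℝ} {c : ℝ}
    (h : ∀ a, g a + c ≤ f a) :
    ∑ a, (p a).toReal * g a + c ≤ ∑ a, (p a).toReal * f a := by
  calc ∑ a, (p a).toReal * g a + c = ∑ a, (p a).toReal * (g a + c) := by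
        simp only [mul_add, Finset.sum_add_distrib, ← Finset.sum_mul, p.sum_toReal_eq_one, one_mul]
    _ ≤ ∑ a, (p a).toReal * f a :=
        Finset.sum_le_sum fun a _ => mul_le_mul_of_nonneg_left (h a) ENNReal.toReal_nonneg

/-- **Termination Improvement (Theorem 1, after Sutton, Precup and Singh).**
Given a finite nonempty state space `S`, a finite nonempty set of options `O`,
a discount factor `γ ∈ [0,1)`, options with kernels `P`, rewards `r`, termination
probabilities `β`, and a meta-control policy `μ`, let `(Q, V)` solve the coupled
Bellman equations.  Interrupting each option additionally whenever `V s > Q s o`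
(i.e. replacing `β` by `β'`) yields a solution `(Q', V')` with `Q' s o ≥ Q s o` for all `s`, `o`. -/
theorem termination_improvement_option_value
    {S O : Type} [Fintype S] [Nonempty S] [Fintype O] [Nonempty O]
    (γ : ℝ) (hγ0 : 0 ≤ γ) (hγ1 : γ < 1)
    (P : O → S → PMF S) (r : O → S → ℝ) (β : O → S → ℝ)
    (hβ0 : ∀ o s, 0 ≤ β o s) (hβ1 : ∀ o s, β o s ≤ 1)
    (μ : S → PMF O)
    (Q : S → O → ℝ) (V : S → ℝ)
    (hQ : ∀ s o, Q s o =
      r o s + γ * ∑ s' : S, (P o s s').toReal *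
        ((1 - β o s') * Q s' o + β o s' * V s'))
    (hV : ∀ s, V s = ∑ o : O, (μ s o).toReal * Q s o)
    (β' : O → S → ℝ)
    (hβ' : ∀ o s, β' o s = if V s > Q s o then 1 else β o s)
    (Q' : S → O → ℝ) (V' : S → ℝ)
    (hQ' : ∀ s o, Q' s o =
      r o s + γ * ∑ s' : S, (P o s s').toReal *
        ((1 - β' o s') * Q' s' o + β' o s' * V' s'))
    (hV' : ∀ s, V' s = ∑ o : O, (μ s o).toReal * Q' s o) :
    ∀ (s : S) (o : O), Q' s o ≥ Q s o := by
  obtain ⟨⟨s₀, o₀⟩, hmin⟩ := Finite.exists_min fun x : S × O => Q' x.1 x.2 - Q x.1 x.2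
  set m := Q' s₀ o₀ - Q s₀ o₀ with hm
  have hQm : ∀ s o, Q s o + m ≤ Q' s o := fun s o => by
    have := hmin (s, o)
    dsimp only at this
    linarith
  have hVm : ∀ s, V s + m ≤ V' s := fun s => by
    rw [hV, hV']
    exact (μ s).sum_toReal_mul_add_const_le (hQm s)
  have hcont : ∀ o s, ((1 - β o s) * Q s o + β o s * V s) + m ≤
      (1 - β' o s) * Q' s o + β' o s * V' s := fun o s => by
    rw [hβ']
    split_ifs with h
    · nlinarith [hVm s, mul_nonneg (sub_nonneg.2 (hβ1 o s)) (sub_nonneg.2 h.le)]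
    · nlinarith [mul_le_mul_of_nonneg_left (hQm s o) (sub_nonneg.2 (hβ1 o s)),
        mul_le_mul_of_nonneg_left (hVm s) (hβ0 o s)]
  have hstep : γ * m ≤ m := by
    have h := mul_le_mul_of_nonneg_left
      ((P o₀ s₀).sum_toReal_mul_add_const_le (hcont o₀)) hγ0
    linarith [hQ s₀ o₀, hQ' s₀ o₀]
  have hm0 : 0 ≤ m := by
    by_contra! hneg
    nlinarith
  intro s o
  linarith [hQm s o]
end

section
/- Let S be a finite nonempty state space, O a finite nonempty set of options, γ ∈ [0,1), options given by kernels P_o : S → PMF(S), rewards r_o : S → ℝ, and termination probabilities β_o : S → [0,1], and μ : S → PMF(O) a meta-control policy. Let (Q, V) solve the coupled Bellman equations Q(s,o) = r_o(s) + γ·Σ_{s'} P_o(s'|s)·[(1 − β_o(s'))·Q(s',o) + β_o(s')·V(s')] and V(s) = Σ_o μ(o|s)·Q(s,o). Define β'_o(s) = 1 if V(s) > Q(s,o) and β'_o(s) = β_o(s) otherwise. Then for every s ∈ S and o ∈ O, r_o(s) + γ·Σ_{s'} P_o(s'|s)·[(1 − β'_o(s'))·Q(s',o) + β'_o(s')·V(s')]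 ≥ Q(s,o); that is, the original value function Q is a pointwise subsolution of the Bellman operator of the interrupted option system. -/
/-- The central one-step calculation of the Termination Improvement theorem:
the original option-value function `Q` is a pointwise subsolution of the Bellman
operator of the interrupted option system (termination probabilities `β'`). -/
theorem original_Q_subsolution_of_interrupted_bellman
    {S O : Type} [Fintype S] [Nonempty S] [Fintype O] [Nonempty O]
    (γ : ℝ) (hγ0 : 0 ≤ γ) (hγ1 : γ < 1)
    (P : O → S → PMF S) (r : O → S → ℝ) (β : O → S → ℝ)
    (hβ0 : ∀ o s, 0 ≤ β o s) (hβ1 : ∀ o s, β o s ≤ 1)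
    (μ : S → PMF O)
    (Q : S → O → ℝ) (V : S → ℝ)
    (hQ : ∀ s o, Q s o =
      r o s + γ * ∑ s' : S, (P o s s').toReal *
        ((1 - β o s') * Q s' o + β o s' * V s'))
    (hV : ∀ s, V s = ∑ o : O, (μ s o).toReal * Q s o)
    (β' : O → S → ℝ)
    (hβ' : ∀ o s, β' o s = if V s > Q s o then 1 else β o s) :
    ∀ (s : S) (o : O),
      r o s + γ * ∑ s' : S, (P o s s').toReal *
        ((1 - β' o s') * Q s' o + β' o s' * V s') ≥ Q s o := by
  intro s o
  rw [ge_iff_le, hQ s o]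
  gcongr r o s + γ * ∑ s', (P o s s').toReal * ?_ with s' _
  rw [hβ' o s']
  split_ifs with h
  · nlinarith [mul_nonneg (sub_nonneg.2 (hβ1 o s')) (sub_nonneg.2 h.le)]
  · exact le_rfl
end
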